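/- arXiv:1712.06382 — 5 statements merged into one kernel-verified Lean document; each statement's English description precedes it below -/
import Mathlib

section
/- For any skew-symmetric matrix A of even order 2N over a commutative ring, the square of the Pfaffian of A equals the determinant of A. -/
open Matrix

/-- Pfaffian of an `n × n` matrix, defined recursively by Laplace-type expansion
along the first row (it agrees with the signed sum over perfect matchings;
it is `0` for odd `n` and `1` for `n = 0`). -/
def pf {R : Type*} [CommRing R] : (n : ℕ) → Matrix (Fin n) (Fin n) R → R
  | 0, _ => 1
  | 1, _ => 0
  | n + 2, M => ∑ j : Fin (n + 1), (-1 : R) ^ (j : ℕ) * M 0 j.succ *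
      pf n ((M.submatrix Fin.succ Fin.succ).submatrix j.succAbove j.succAbove)

namespace ExteriorAlgebra

open CliffordAlgebra (contractLeft changeForm)

variable {R V : Type*} [CommRing R] [AddCommGroup V] [Module R V]

theorem contractLeft_ιMulti (d : Module.Dual R V) {n : ℕ} (v : Fin (n + 1) → V) :
    contractLeft (Q := (0 : QuadraticForm R V)) d (ιMulti R (n + 1) v) =
      ∑ j : Fin (n + 1), ((-1 : R) ^ (j : ℕ) * d (v j)) • ιMulti R n (v ∘ j.succAbove) := by
  induction n with
  | zero =>
    rw [ιMulti_succ_apply]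
    erw [CliffordAlgebra.contractLeft_ι_mul]
    simp
  | succ n ih =>
    rw [ιMulti_succ_apply]
    erw [CliffordAlgebra.contractLeft_ι_mul]
    erw [ih]
    rw [Fin.sum_univ_succ (n := n + 1), Finset.mul_sum, sub_eq_add_neg, ← Finset.sum_neg_distrib]
    congr 1
    · simp only [Fin.val_zero, pow_zero, one_mul]
      rfl
    · refine Finset.sum_congr rfl fun j _ => ?_
      rw [ιMulti_succ_apply, mul_smul_comm, ← neg_smul]
      congr 1
      · simp only [Fin.val_succ, pow_succ, Matrix.vecTail, Function.comp]
        ring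
      · congr 2
        ext k
        simp [Matrix.vecTail]

/-- The Pfaffian of the Gram matrix of a family of vectors with respect to an alternating bilinear
form, as an alternating map of the family. -/
def pfaffianMap (B : LinearMap.BilinForm R V)
    (h : (-B).toQuadraticMap = (0 : QuadraticForm R V) - 0) (n : ℕ) : V [⋀^Fin n]→ₗ[R] R :=
  ((algebraMapInv (R := R) (M := V)).toLinearMap ∘ₗ changeForm h).compAlternatingMap (ιMulti R n)

theorem pfaffianMap_eq_pf (B : LinearMap.BilinForm R V)
    (h : (-B).toQuadraticMap = (0 : QuadraticForm R V) - 0) :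
    ∀ (n : ℕ) (v : Fin n → V),
      pfaffianMap B h n v = pf n (Matrix.of fun i j => B (v i) (v j))
  | 0, v => by
    have h1 : ιMulti R 0 v = 1 := by simp
    have h2 := CliffordAlgebra.changeForm_one h
    simp only [pfaffianMap, LinearMap.compAlternatingMap_apply, h1, LinearMap.comp_apply, pf]
    erw [h2]
    exact map_one (algebraMapInv (R := R) (M := V))
  | 1, v => by
    have h1 : ιMulti R 1 v = ι R (v 0) := by simp
    have h2 := CliffordAlgebra.changeForm_ι h (v 0)
    simp only [pfaffianMap, LinearMap.compAlternatingMap_apply, h1, LinearMap.comp_apply, pf]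
    erw [h2]
    exact (lift_ι_apply R _ _ _).trans rfl
  | n + 2, v => by
    have h2 := CliffordAlgebra.changeForm_ι_mul h (v 0) (ιMulti R (n + 1) (Matrix.vecTail v))
    rw [← CliffordAlgebra.changeForm_contractLeft, contractLeft_ιMulti] at h2
    simp only [pfaffianMap, LinearMap.compAlternatingMap_apply, LinearMap.comp_apply, pf]
    rw [ιMulti_succ_apply]
    erw [h2]
    have h3 : ∀ x : ExteriorAlgebra R V,
        algebraMapInv (ι R (v 0) * x) = (0 : R) := fun x => by
      rw [map_mul, show algebraMapInv (ι R (v 0)) = (0 : R) from lift_ι_apply R _ _ _, zero_mul]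
    rw [AlgHom.toLinearMap_apply, map_sub]
    erw [h3]
    rw [zero_sub, map_sum, map_sum, ← Finset.sum_neg_distrib]
    refine Finset.sum_congr rfl fun j _ => ?_
    rw [map_smul, map_smul]
    have ih := pfaffianMap_eq_pf B h n (Matrix.vecTail v ∘ j.succAbove)
    simp only [pfaffianMap, LinearMap.compAlternatingMap_apply, LinearMap.comp_apply,
      AlgHom.toLinearMap_apply] at ih
    erw [ih]
    simp only [LinearMap.neg_apply, smul_eq_mul, mul_neg, neg_mul, neg_neg]
    rfl

end ExteriorAlgebra

theorem pf_mul_mul_transpose {R : Type*} [CommRing R] {n : ℕ} (C A : Matrix (Fin n) (Fin n) R)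
    (hA : ∀ v, v ⬝ᵥ A *ᵥ v = 0) : pf n (C * A * Cᵀ) = C.det * pf n A := by
  let B : LinearMap.BilinForm R (Fin n → R) := Matrix.toLinearMap₂' R A
  have h : (-B).toQuadraticMap = (0 : QuadraticForm R (Fin n → R)) - 0 := by
    ext v
    simp [B, Matrix.toLinearMap₂'_apply', hA]
  let e := Pi.basisFun R (Fin n)
  have key : ExteriorAlgebra.pfaffianMap B h n C.row =
      ExteriorAlgebra.pfaffianMap B h n e * C.det :=
    (DFunLike.congr_fun ((ExteriorAlgebra.pfaffianMap B h n).eq_smul_basis_det e) C.row).trans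
      (congrArg (ExteriorAlgebra.pfaffianMap B h n e * ·) (Pi.basisFun_det_apply C.row))
  rw [ExteriorAlgebra.pfaffianMap_eq_pf, ExteriorAlgebra.pfaffianMap_eq_pf, mul_comm] at key
  convert key using 2
  · ext i j
    simp only [Matrix.of_apply, B, Matrix.toLinearMap₂'_apply', Matrix.mul_assoc]
    rfl
  · congr 1
    ext i j
    simp [B, e, Matrix.toLinearMap₂'_apply']

theorem pf_map {R S : Type*} [CommRing R] [CommRing S] (f : R →+* S) :
    ∀ (n : ℕ) (A : Matrix (Fin n) (Fin n) R), pf n (A.map f) = f (pf n A)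
  | 0, _ => by simp [pf]
  | 1, _ => by simp [pf]
  | n + 2, A => by
    simp only [pf, map_sum, map_mul, map_pow, map_neg, map_one, ← pf_map f n, Matrix.map_apply]
    rfl

theorem pf_of_row_eq_zero {R : Type*} [CommRing R] {n : ℕ}
    (A : Matrix (Fin (n + 2)) (Fin (n + 2)) R) (h : ∀ j : Fin n, A 0 j.succ.succ = 0) :
    pf (n + 2) A = A 0 1 * pf n (A.submatrix (Fin.succ ∘ Fin.succ) (Fin.succ ∘ Fin.succ)) := by
  simp only [pf]
  rw [Fin.sum_univ_succ, Finset.sum_eq_zero fun j _ => by rw [h]; ring]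
  simp

theorem dotProduct_mulVec_self_of_transpose_eq_neg {K n : Type*} [Field K] [CharZero K] [Fintype n]
    {A : Matrix n n K} (hA : Aᵀ = -A) (v : n → K) : v ⬝ᵥ A *ᵥ v = 0 := by
  refine self_eq_neg.mp ?_
  conv_lhs => rw [Matrix.dotProduct_mulVec, ← Matrix.mulVec_transpose, hA, dotProduct_comm]
  simp [Matrix.neg_mulVec]

theorem pf_sq_eq_det_of_ne_zero {K : Type*} [Field K] [CharZero K] {n : ℕ}
    (ih : ∀ S : Matrix (Fin n) (Fin n) K, Sᵀ = -S → pf n S ^ 2 = S.det)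
    (A : Matrix (Fin (n + 2)) (Fin (n + 2)) K) (hA : Aᵀ = -A) (h01 : A 0 1 ≠ 0) :
    pf (n + 2) A ^ 2 = A.det := by
  have hskew (i j) : A j i = - A i j := congrFun₂ hA i j
  have hdiag (i) : A i i = 0 := self_eq_neg.mp (hskew i i)
  let e : Fin 2 ⊕ Fin n ≃ Fin (n + 2) := finSumFinEquiv.trans (finCongr (add_comm 2 n))
  have e0 : e (Sum.inl 0) = 0 := rfl
  have e1 : e (Sum.inl 1) = 1 := by ext; simp [e]
  have e2 (k : Fin n) : e (Sum.inr k) = k.succ.succ := by ext; simp [e]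
  let M := A.submatrix e e
  let P := M.toBlocks₁₁
  let Q := M.toBlocks₁₂
  let S := M.toBlocks₂₂
  have hP : P.det = A 0 1 ^ 2 := by
    simp [P, M, Matrix.det_fin_two, Matrix.toBlocks₁₁, e0, e1, hdiag, hskew 0 1, sq]
  have : Invertible P := Matrix.invertibleOfIsUnitDet P (by
     rw [hP]; exact (pow_ne_zero 2 h01).isUnit)
  have hPt : Pᵀ = -P := by ext i j; exact hskew _ _
  have hSt : Sᵀ = -S := by ext i j; exact hskew _ _
  have hQ : M.toBlocks₂₁ = -Qᵀ := by ext i j; exact hskew _ _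
  have hPi : (P⁻¹)ᵀ = -P⁻¹ := by
    rw [Matrix.transpose_nonsing_inv, hPt]
    exact Matrix.inv_eq_right_inv (by simp)
  let S' := S + Qᵀ * P⁻¹ * Q
  have hS' : S'ᵀ = -S' := by
    simp [S', hSt, hPi, Matrix.mul_assoc, add_comm]
  let L := Matrix.fromBlocks (1 : Matrix (Fin 2) (Fin 2) K) 0 (-Qᵀ * P⁻¹)
    (1 : Matrix (Fin n) (Fin n) K)
  let D := Matrix.fromBlocks P 0 0 S'
  have hM : M = L * D * Lᵀ := by
    rw [← Matrix.fromBlocks_toBlocks M, hQ]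
    change Matrix.fromBlocks P Q (-Qᵀ) S = _
    rw [Matrix.fromBlocks_eq_of_invertible₁₁]
    simp [L, D, S', Matrix.fromBlocks_transpose, hPi]
  have hL : L.det = 1 := by simp [L]
  have hDt : Dᵀ = -D := by simp [D, Matrix.fromBlocks_transpose, Matrix.fromBlocks_neg, hPt, hS']
  let L' := L.submatrix e.symm e.symm
  let D' := D.submatrix e.symm e.symm
  have hA' : A = L' * D' * L'ᵀ := by
    have : A = M.submatrix e.symm e.symm := by simp [M]
    rw [this, hM]
    simp [L', D', Matrix.submatrix_mul_equiv]
  have hpf : pf (n + 2) D' = A 0 1 * pf n S' := by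
    have s0 : e.symm 0 = Sum.inl 0 := by rw [← e0, e.symm_apply_apply]
    have s1 : e.symm 1 = Sum.inl 1 := by rw [← e1, e.symm_apply_apply]
    have s2 (k : Fin n) : e.symm k.succ.succ = Sum.inr k := by rw [← e2, e.symm_apply_apply]
    rw [pf_of_row_eq_zero _ fun j => by simp [D', D, s0, s2]]
    have hD01 : D' 0 1 = A 0 1 := by
      simp [D', D, s0, s1, P, M, Matrix.toBlocks₁₁, e0, e1]
    have hD : D'.submatrix (Fin.succ ∘ Fin.succ) (Fin.succ ∘ Fin.succ) = S' := by
      ext i j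
      simp [D', D, s2]
    rw [hD01, hD]
  have hDt' : D'ᵀ = -D' := by
    simp only [D', Matrix.transpose_submatrix, hDt]; rfl
  have hdet : A.det = A 0 1 ^ 2 * S'.det := by
    rw [← Matrix.det_submatrix_equiv_self e, show A.submatrix e e = M from rfl, hM]
    simp [hL, D, hP]
  rw [hdet, ← ih S' hS', ← mul_pow, ← hpf]
  conv_lhs => rw [hA', pf_mul_mul_transpose _ _ (dotProduct_mulVec_self_of_transpose_eq_neg hDt'),
    Matrix.det_submatrix_equiv_self, hL, one_mul]

theorem pf_sq_eq_det_of_field {K : Type*} [Field K] [CharZero K] (N : ℕ)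
    (A : Matrix (Fin (2 * N)) (Fin (2 * N)) K) (hA : Aᵀ = -A) : pf (2 * N) A ^ 2 = A.det := by
  induction N with
  | zero => simp [pf]
  | succ N ih =>
    change Matrix (Fin (2 * N + 2)) (Fin (2 * N + 2)) K at A
    change pf (2 * N + 2) A ^ 2 = A.det
    by_cases h : ∃ j : Fin (2 * N + 1), A 0 j.succ ≠ 0
    · obtain ⟨j, hj⟩ := h
      let σ : Equiv.Perm (Fin (2 * N + 2)) := Equiv.swap 1 j.succ
      let C : Matrix (Fin (2 * N + 2)) (Fin (2 * N + 2)) K := σ.permMatrix K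
      have hC : C * A * Cᵀ = A.submatrix σ σ := by
        rw [← Matrix.mul_one (A.submatrix σ σ)]
        simp only [C, Matrix.transpose_permMatrix, PEquiv.toMatrix_toPEquiv_mul,
          PEquiv.mul_toMatrix_toPEquiv, Matrix.submatrix_submatrix, Matrix.mul_one]
        rfl
      have hCC : C.det ^ 2 = 1 := by
        simp only [C, Matrix.det_permutation]
        rw [← Int.cast_pow, ← Units.val_pow_eq_pow_val, Int.units_sq]
        simp
      have key := pf_sq_eq_det_of_ne_zero ih (A.submatrix σ σ)
        (by rw [Matrix.transpose_submatrix, hA]; rfl)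
        (by
          have : σ 0 = 0 := Equiv.swap_apply_of_ne_of_ne (by simp) (Fin.succ_ne_zero j).symm
          simpa [this, σ] using hj)
      rwa [← hC, pf_mul_mul_transpose _ _ (dotProduct_mulVec_self_of_transpose_eq_neg hA), mul_pow,
        hCC, one_mul, hC, Matrix.det_submatrix_equiv_self] at key
    · push Not at h
      rw [Matrix.det_eq_zero_of_row_eq_zero 0 fun j => ?_]
      · simp [pf, h]
      · induction j using Fin.cases with
        | zero => exact self_eq_neg.mp (congrFun₂ hA 0 0)
        | succ j => exact h j

/-- for a skew-symmetric matrix of even order `2N` over a commutative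
ring, the square of the Pfaffian equals the determinant. -/
theorem pf_sq_eq_det {R : Type*} [CommRing R] (N : ℕ)
    (A : Matrix (Fin (2 * N)) (Fin (2 * N)) R)
    (hA : Aᵀ = -A) (hdiag : ∀ i, A i i = 0) :
    (pf (2 * N) A) ^ 2 = A.det := by
  let U := MvPolynomial (Fin (2 * N) × Fin (2 * N)) ℤ
  let X : Matrix (Fin (2 * N)) (Fin (2 * N)) U := Matrix.of fun i j => MvPolynomial.X (i, j)
  let G := X - Xᵀ
  let f : U →+* R := MvPolynomial.eval₂Hom (Int.castRingHom R) fun p =>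
    if p.1 < p.2 then A p.1 p.2 else 0
  have hf (i j) : f (X i j) = if i < j then A i j else 0 := MvPolynomial.eval₂Hom_X' _ _ _
  have hG : G.map f = A := by
    ext i j
    have hskew : A j i = -A i j := congrFun₂ hA i j
    change f (X i j - X j i) = A i j
    rw [map_sub, hf, hf]
    rcases lt_trichotomy i j with h | rfl | h
    · simp [h, h.not_gt]
    · simp [hdiag]
    · simp [h, h.not_gt, hskew]
  have key : pf (2 * N) G ^ 2 = G.det := by
    have : CharZero (FractionRing U) := charZero_of_injective_algebraMap (IsFractionRing.injective U _)
    apply IsFractionRing.injective U (FractionRing U)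
    rw [map_pow, ← pf_map, RingHom.map_det]
    refine pf_sq_eq_det_of_field N _ ?_
    ext i j
    simp [G]
  rw [← hG, pf_map, ← map_pow, key, RingHom.map_det]
  rfl
end

section
/- Let A be a skew-symmetric matrix of odd size 2n-1, let x, y ∈ ℝ^{2n-1} and z ∈ ℝ. Then det of the 2n×2n matrix obtained by bordering A with column x, row -yᵀ, and corner entry z equals Pf(B)·Pf(C), where B is A bordered skew-symmetrically by x (corner 0) and C is A bordered skew-symmetrically by y (corner 0). -/
open Matrix

/-- Border an `m × m` matrix `A` by a last column `x`, last row `-y`, and corner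
entry `z`, giving the `(m+1) × (m+1)` matrix `[[A, x], [-yᵀ, z]]`. -/
def border {m : ℕ} (A : Matrix (Fin m) (Fin m) ℝ) (x y : Fin m → ℝ) (z : ℝ) :
    Matrix (Fin (m + 1)) (Fin (m + 1)) ℝ :=
  Matrix.of fun i j =>
    if hi : (i : ℕ) < m then
      if hj : (j : ℕ) < m then A ⟨i, hi⟩ ⟨j, hj⟩ else x ⟨i, hi⟩
    else
      if hj : (j : ℕ) < m then -(y ⟨j, hj⟩) else z


open Equiv

theorem exists_perm_comp_succAbove {n : ℕ} (s : Perm (Fin (n + 1))) (k : Fin (n + 1)) :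
    ∃ t : Perm (Fin n), (∀ j, s (k.succAbove j) = (s k).succAbove (t j)) ∧
      Perm.sign t = (-1) ^ (s k : ℕ) * Perm.sign s * (-1) ^ (k : ℕ) := by
  obtain ⟨⟨p, t⟩, ht⟩ := Perm.decomposeFin.symm.surjective
    ((s k).cycleRange * s * (k.cycleRange)⁻¹)
  have hp : p = 0 := by
    rw [← Perm.decomposeFin_symm_apply_zero p t, ht]
    simp [Perm.inv_def]
  subst hp
  refine ⟨t, fun j => ?_, ?_⟩
  · have := congrArg (fun e : Perm (Fin (n + 1)) => e j.succ) ht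
    simp [Perm.inv_def] at this
    rw [← Fin.cycleRange_symm_succ (s k), this, symm_apply_apply]
  · have := congrArg Perm.sign ht
    simpa [Perm.decomposeFin.symm_sign, Fin.sign_cycleRange] using this

section CommRing

variable {R : Type*} [CommRing R]

theorem pf_succ_succ (n : ℕ) (M : Matrix (Fin (n + 2)) (Fin (n + 2)) R) :
    pf (n + 2) M = ∑ j : Fin (n + 1), (-1 : R) ^ (j : ℕ) * M 0 j.succ *
      pf n ((M.submatrix Fin.succ Fin.succ).submatrix j.succAbove j.succAbove) := rfl

theorem transpose_submatrix_eq_neg {m l : Type*} {M : Matrix m m R} (hM : Mᵀ = -M) (f : l → m) :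
    (M.submatrix f f)ᵀ = -M.submatrix f f := by
  ext i j
  exact congrFun (congrFun hM (f i)) (f j)

/-- Simultaneous exchange of the first two rows and columns negates the Pfaffian. -/
theorem pf_submatrix_swap_zero_one {n : ℕ} (M : Matrix (Fin (n + 2)) (Fin (n + 2)) R)
    (hM : Mᵀ = -M) :
    pf (n + 2) (M.submatrix (swap 0 1) (swap 0 1)) = -pf (n + 2) M := by
  have h10 : M 1 0 = -M 0 1 := congrFun (congrFun hM 0) 1
  have hs (k : Fin n) : swap (0 : Fin (n + 2)) 1 k.succ.succ = k.succ.succ :=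
    swap_apply_of_ne_of_ne (Fin.succ_ne_zero _)
      (by rw [← Fin.succ_zero_eq_one]; exact (Fin.succ_injective _).ne (Fin.succ_ne_zero _))
  match n with
  | 0 => simp [pf, h10]
  | 1 => simp [pf]
  | m + 2 =>
    have expand (N : Matrix (Fin (m + 4)) (Fin (m + 4)) R) : pf (m + 4) N =
        N 0 1 * pf (m + 2) (N.submatrix (fun i => i.succ.succ) (fun i => i.succ.succ)) -
        ∑ p : Fin (m + 2) × Fin (m + 1), (-1 : R) ^ (p.1 + p.2 : ℕ) *
          (N 0 p.1.succ.succ * N 1 (p.1.succAbove p.2).succ.succ) *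
          pf m (N.submatrix (fun i => (p.1.succAbove (p.2.succAbove i)).succ.succ)
            (fun i => (p.1.succAbove (p.2.succAbove i)).succ.succ)) := by
      rw [pf_succ_succ, Fin.sum_univ_succ, sub_eq_add_neg, Fintype.sum_prod_type,
        ← Finset.sum_neg_distrib]
      congr 1
      · simp [Function.comp_def]
      · refine Finset.sum_congr rfl fun k _ => ?_
        rw [pf_succ_succ, Finset.mul_sum, ← Finset.sum_neg_distrib]
        refine Finset.sum_congr rfl fun l _ => ?_
        simp only [submatrix_apply, submatrix_submatrix, Function.comp_def,
          Fin.succ_succAbove_zero, Fin.succ_succAbove_succ, Fin.succ_zero_eq_one, Fin.val_succ]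
        ring
    rw [expand, expand]
    simp only [submatrix_apply, submatrix_submatrix, Function.comp_def, hs, swap_apply_left,
      swap_apply_right, h10]
    rw [neg_sub, sub_eq_add_neg, add_comm, neg_mul, ← sub_eq_add_neg]
    congr 1
    rw [← Finset.sum_neg_distrib]
    let e : Fin (m + 2) × Fin (m + 1) → Fin (m + 2) × Fin (m + 1) :=
      fun p => (p.1.succAbove p.2, p.2.predAbove p.1)
    have he (p) : e (e p) = p := by
      simp [e, Fin.succAbove_succAbove_predAbove, Fin.predAbove_predAbove_succAbove]
    refine Finset.sum_nbij' e e (by simp) (by simp) (fun p _ => he p) (fun p _ => he p)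
      fun p _ => ?_
    simp only [e, Fin.succAbove_succAbove_predAbove, Fin.neg_one_pow_succAbove_add_predAbove,
      Fin.succAbove_succAbove_succAbove_predAbove]
    ring

/-- Simultaneous permutation of rows and columns multiplies the Pfaffian by the sign. -/
theorem pf_submatrix_perm : {n : ℕ} → (M : Matrix (Fin n) (Fin n) R) → Mᵀ = -M →
    (σ : Perm (Fin n)) → pf n (M.submatrix σ σ) = (Perm.sign σ : ℤ) * pf n M
  | 0, _, _, σ => by simp [pf, Subsingleton.elim σ 1]
  | 1, _, _, _ => by simp [pf]
  | n + 2, M, hM, σ => by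
    have hσ : σ ∈ Submonoid.closure
        (Set.range fun i : Fin (n + 1) => swap i.castSucc i.succ) := by
      rw [Perm.mclosure_swap_castSucc_succ]; trivial
    induction hσ using Submonoid.closure_induction generalizing M with
    | one => simp
    | mul a b _ _ ha hb =>
      have := hb (M.submatrix a a) (transpose_submatrix_eq_neg hM a)
      rw [ha M hM, submatrix_submatrix] at this
      rw [Perm.coe_mul, this]
      simp
      ring
    | mem σ h =>
      obtain ⟨i, rfl⟩ := h
      induction i using Fin.cases with
      | zero =>
        simpa [Perm.sign_swap] using pf_submatrix_swap_zero_one M hM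
      | succ i =>
        set s : Perm (Fin (n + 1)) := swap i.castSucc i.succ with hs
        have h0 : swap i.succ.castSucc i.succ.succ 0 = (0 : Fin (n + 2)) :=
          swap_apply_of_ne_of_ne (by simp [Fin.ext_iff]) (Fin.succ_ne_zero _).symm
        have hsucc (k : Fin (n + 1)) : swap i.succ.castSucc i.succ.succ k.succ = (s k).succ := by
          rw [← Fin.succ_castSucc, hs, (Fin.succ_injective _).swap_apply]
        have hsign : Perm.sign (swap i.succ.castSucc i.succ.succ) = Perm.sign s := by
          rw [hs, Perm.sign_swap (by simp [Fin.ext_iff]), Perm.sign_swap (by simp [Fin.ext_iff])]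
        rw [pf_succ_succ, pf_succ_succ, hsign]
        conv_rhs => rw [← Equiv.sum_comp s, Finset.mul_sum]
        refine Finset.sum_congr rfl fun k _ => ?_
        obtain ⟨t, ht, hts⟩ := exists_perm_comp_succAbove s k
        have := pf_submatrix_perm ((M.submatrix Fin.succ Fin.succ).submatrix (s k).succAbove
          (s k).succAbove)
          (transpose_submatrix_eq_neg (transpose_submatrix_eq_neg hM _) _) t
        simp only [submatrix_submatrix, submatrix_apply, Function.comp_def, h0, hsucc, ht]
          at this ⊢
        rw [this, hts]
        push_cast
        have hk : ((-1 : R) ^ (k : ℕ)) * (-1) ^ (k : ℕ) = 1 := by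
          rw [← mul_pow]; simp
        linear_combination ((-1 : R) ^ (s k : ℕ) * ((Perm.sign s : ℤ) : R) * M 0 (s k).succ *
          pf n (M.submatrix (fun x => ((s k).succAbove x).succ)
            fun x => ((s k).succAbove x).succ)) * hk

/-- The matrix `[[w, u], [x, A]]`. -/
def borderFirst {m : ℕ} (w : R) (u x : Fin m → R) (A : Matrix (Fin m) (Fin m) R) :
    Matrix (Fin (m + 1)) (Fin (m + 1)) R :=
  Matrix.of (Fin.cons (Fin.cons w u) fun i => Fin.cons (x i) (A i))

/-- The signed sub-Pfaffians obtained by deleting one index. -/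
def subPf {m : ℕ} (A : Matrix (Fin (m + 1)) (Fin (m + 1)) R) (j : Fin (m + 1)) : R :=
  (-1) ^ (j : ℕ) * pf m (A.submatrix j.succAbove j.succAbove)

theorem pf_eq_dotProduct_subPf {m : ℕ} (M : Matrix (Fin (m + 2)) (Fin (m + 2)) R) :
    pf (m + 2) M =
      (fun j : Fin (m + 1) => M 0 j.succ) ⬝ᵥ subPf (M.submatrix Fin.succ Fin.succ) := by
  rw [pf_succ_succ]
  exact Finset.sum_congr rfl fun j _ => by rw [subPf]; ring

theorem det_borderFirst {m : ℕ} (w : R) (u x : Fin m → R) (A : Matrix (Fin m) (Fin m) R) :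
    (borderFirst w u x A).det = w * A.det - u ⬝ᵥ A.adjugate *ᵥ x := by
  rw [det_succ_row_zero, Fin.sum_univ_succ, sub_eq_add_neg, dotProduct, ← Finset.sum_neg_distrib]
  congr 1
  · simp only [borderFirst, Fin.val_zero, pow_zero, one_mul, Fin.succAbove_zero]
    rfl
  · refine Finset.sum_congr rfl fun k _ => ?_
    rw [← cramer_eq_adjugate_mulVec, cramer_apply]
    have : (borderFirst w u x A).submatrix Fin.succ k.succ.succAbove =
        (A.updateCol k x).submatrix id k.cycleRange.symm := by
      ext i j
      cases m with
      | zero => exact k.elim0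
      | succ m =>
        induction j using Fin.cases with
        | zero => simp [borderFirst]
        | succ j => simp [borderFirst]
    rw [this, det_permute', Perm.sign_symm, Fin.sign_cycleRange]
    have hk : ((-1 : R) ^ (k : ℕ)) * (-1) ^ (k : ℕ) = 1 := by
      rw [← mul_pow]; simp
    simp only [borderFirst, Fin.val_succ, of_apply, Fin.cons_zero, Fin.cons_succ]
    push_cast
    linear_combination (-(u k * (A.updateCol k x).det)) * hk

end CommRing

/-- The signed sub-Pfaffians of a skew-symmetric matrix form a vector in its kernel. -/
theorem mulVec_subPf {m : ℕ} (A : Matrix (Fin (m + 1)) (Fin (m + 1)) ℝ) (hA : Aᵀ = -A) :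
    A *ᵥ subPf A = 0 := by
  ext i
  set f : Fin (m + 2) → Fin (m + 1) := Fin.cons i id with hf
  have hfs : f ∘ swap 0 i.succ = f := by
    funext j
    rcases eq_or_ne j 0 with rfl | h0
    · simp [hf]
    · rcases eq_or_ne j i.succ with rfl | h1
      · simp [hf]
      · simp [swap_apply_of_ne_of_ne h0 h1]
  have h := pf_submatrix_perm (A.submatrix f f) (transpose_submatrix_eq_neg hA f) (swap 0 i.succ)
  rw [submatrix_submatrix, hfs, Perm.sign_swap (Fin.succ_ne_zero i).symm,
    pf_eq_dotProduct_subPf] at h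
  have hsub : (A.submatrix f f).submatrix Fin.succ Fin.succ = A := by
    ext; simp [hf]
  rw [hsub] at h
  have : (fun j : Fin (m + 1) => A.submatrix f f 0 j.succ) = A i := by
    ext; simp [hf]
  rw [this] at h
  simp only [mulVec, Pi.zero_apply]
  push_cast at h
  linarith

theorem adjugate_eq_zero_of_mulVec_eq_zero {ι K : Type*} [Fintype ι] [DecidableEq ι] [Field K]
    {A : Matrix ι ι K} {t : ι → K} (ht : t ≠ 0) (hAt : A *ᵥ t = 0) {i : ι} (hi : t i = 0) (j : ι) :
    A.adjugate i j = 0 := by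
  rw [adjugate_apply, ← exists_mulVec_eq_zero_iff]
  refine ⟨t, ht, funext fun k => ?_⟩
  rcases eq_or_ne k j with rfl | hk
  · simp [mulVec, hi]
  · simpa [mulVec, updateRow_ne hk] using congrFun hAt k

/-- A symmetric adjugate whose diagonal is the square of a kernel vector `q` equals `q qᵀ`. -/
theorem adjugate_eq_vecMulVec {ι K : Type*} [Fintype ι] [DecidableEq ι] [Field K]
    {A : Matrix ι ι K} (hdet : A.det = 0) (hsymm : A.adjugate.IsSymm) {q : ι → K}
    (hq : A *ᵥ q = 0) (hdiag : ∀ i, A.adjugate i i = q i ^ 2) :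
    A.adjugate = vecMulVec q q := by
  have hcol (j : ι) : A *ᵥ (fun k => A.adjugate k j) = 0 := by
    have h := A.mul_adjugate
    rw [hdet, zero_smul] at h
    exact funext fun i => congrFun (congrFun h i) j
  by_cases h : ∃ i, A.adjugate i i ≠ 0
  · obtain ⟨i, hi⟩ := h
    have hqi : q i ≠ 0 := fun h0 => hi (by simp [hdiag, h0])
    have key (l : ι) (k : ι) : q i * A.adjugate k l = A.adjugate i l * q k := by
      by_contra hne
      refine hi (adjugate_eq_zero_of_mulVec_eq_zero
        (t := q i • (fun k => A.adjugate k l) - A.adjugate i l • q) (fun h0 => hne ?_) ?_ ?_ i)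
      · simpa [sub_eq_zero] using congrFun h0 k
      · rw [mulVec_sub, mulVec_smul, mulVec_smul, hcol, hq]; simp
      · simp [mul_comm]
    have hi' (k : ι) : A.adjugate i k = q i * q k := by
      rw [← hsymm.apply]
      refine mul_left_cancel₀ hqi ?_
      rw [key i k, hdiag]; ring
    ext k l
    refine mul_left_cancel₀ hqi ?_
    rw [key, hi', vecMulVec_apply]; ring
  · push Not at h
    have hq0 (i : ι) : q i = 0 := by simpa [hdiag] using h i
    ext i j
    rw [vecMulVec_apply, hq0, zero_mul]
    by_contra hne
    refine hne (adjugate_eq_zero_of_mulVec_eq_zero (t := fun k => A.adjugate k i)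
      (fun h0 => hne ?_) (hcol i) (h i) j)
    rw [← hsymm.apply]
    exact congrFun h0 j

theorem det_eq_zero_of_skew_of_odd {n : ℕ} {A : Matrix (Fin (2 * n + 1)) (Fin (2 * n + 1)) ℝ}
    (hA : Aᵀ = -A) : A.det = 0 := by
  have h := congrArg det hA
  rw [det_transpose, det_neg, Fintype.card_fin, (odd_two_mul_add_one n).neg_one_pow] at h
  linarith

theorem adjugate_eq_of_det_eq_pf_sq {n : ℕ}
    (ih : ∀ M : Matrix (Fin (2 * n)) (Fin (2 * n)) ℝ, Mᵀ = -M → M.det = pf (2 * n) M ^ 2)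
    {A : Matrix (Fin (2 * n + 1)) (Fin (2 * n + 1)) ℝ} (hA : Aᵀ = -A) :
    A.adjugate = vecMulVec (subPf A) (subPf A) := by
  refine adjugate_eq_vecMulVec (det_eq_zero_of_skew_of_odd hA) ?_ (mulVec_subPf A hA) fun i => ?_
  · rw [IsSymm, adjugate_transpose, hA, ← neg_one_smul ℝ A, adjugate_smul]
    simp
  · rw [adjugate_fin_succ_eq_det_submatrix, ih _ (transpose_submatrix_eq_neg hA _), subPf, mul_pow,
      ← pow_mul, pow_mul']
    simp

theorem det_eq_pf_sq (n : ℕ) : ∀ M : Matrix (Fin (2 * n)) (Fin (2 * n)) ℝ, Mᵀ = -M →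
    M.det = pf (2 * n) M ^ 2 := by
  induction n with
  | zero => intro M _; simp [pf]
  | succ n ih =>
    intro (M : Matrix (Fin (2 * n + 2)) (Fin (2 * n + 2)) ℝ) hM
    change M.det = pf (2 * n + 2) M ^ 2
    set A := M.submatrix Fin.succ Fin.succ with hA
    set u : Fin (2 * n + 1) → ℝ := fun j => M 0 j.succ with hu
    have hskew : Aᵀ = -A := transpose_submatrix_eq_neg hM _
    have hMb : M = borderFirst (M 0 0) u (-u) A := by
      ext i j
      induction i using Fin.cases with
      | zero => induction j using Fin.cases <;> simp [borderFirst, hu]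
      | succ i =>
        induction j using Fin.cases with
        | zero => simpa [borderFirst, hu] using congrFun (congrFun hM 0) i.succ
        | succ j => simp [borderFirst, hA]
    rw [pf_eq_dotProduct_subPf, ← hA, ← hu, hMb, det_borderFirst,
      det_eq_zero_of_skew_of_odd hskew, adjugate_eq_of_det_eq_pf_sq ih hskew,
      vecMulVec_mulVec]
    simp [dotProduct_comm (subPf A) u, sq]

theorem border_eq_submatrix_borderFirst {m : ℕ} (A : Matrix (Fin m) (Fin m) ℝ)
    (x y : Fin m → ℝ) (z : ℝ) :
    border A x y z =
      (borderFirst z (-y) x A).submatrix (finRotate (m + 1)) (finRotate (m + 1)) := by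
  have hrot (k : Fin m) : finRotate (m + 1) k.castSucc = k.succ := by
    simp [finRotate_apply]
  ext i j
  induction i using Fin.lastCases <;> induction j using Fin.lastCases <;>
    simp [border, borderFirst, hrot]

theorem pf_border {n : ℕ} {A : Matrix (Fin (2 * n + 1)) (Fin (2 * n + 1)) ℝ} (hA : Aᵀ = -A)
    (x : Fin (2 * n + 1) → ℝ) : pf (2 * n + 1 + 1) (border A x x 0) = x ⬝ᵥ subPf A := by
  have hskew : (borderFirst 0 (-x) x A)ᵀ = -borderFirst 0 (-x) x A := by
    ext i j
    induction i using Fin.cases with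
    | zero => induction j using Fin.cases <;> simp [borderFirst]
    | succ i =>
      induction j using Fin.cases with
      | zero => simp [borderFirst]
      | succ j => simpa [borderFirst] using congrFun (congrFun hA i) j
  have hsub : (borderFirst 0 (-x) x A).submatrix Fin.succ Fin.succ = A := by
    ext; simp [borderFirst]
  have hrow : (fun j : Fin (2 * n + 1) => borderFirst 0 (-x) x A 0 j.succ) = -x := by
    ext; simp [borderFirst]
  rw [border_eq_submatrix_borderFirst, pf_submatrix_perm _ hskew, sign_finRotate,
    pf_eq_dotProduct_subPf, hsub, hrow]
  simp [pow_add, pow_mul]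

/-- for a skew-symmetric matrix `A` of odd size, vectors `x, y`
and a scalar `z`, the determinant of `[[A, x], [-yᵀ, z]]` equals
`Pf([[A, x], [-xᵀ, 0]]) * Pf([[A, y], [-yᵀ, 0]])`. -/
theorem det_border_odd_eq_pf_mul_pf (n : ℕ)
    (A : Matrix (Fin (2 * n + 1)) (Fin (2 * n + 1)) ℝ) (hA : Aᵀ = -A)
    (x y : Fin (2 * n + 1) → ℝ) (z : ℝ) :
    (border A x y z).det
      = pf (2 * n + 1 + 1) (border A x x 0) * pf (2 * n + 1 + 1) (border A y y 0) := by
  rw [pf_border hA, pf_border hA, border_eq_submatrix_borderFirst, det_submatrix_equiv_self,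
    det_borderFirst, det_eq_zero_of_skew_of_odd hA,
    adjugate_eq_of_det_eq_pf_sq (det_eq_pf_sq n) hA, vecMulVec_mulVec]
  simp [dotProduct_comm (subPf A) x]
end

section
/- (Schur's Pfaffian identity, odd case) For variables s_1, ..., s_{2N-1}, the Pfaffian of the 2N×2N skew-symmetric matrix whose first row is (0, 1, 1, ..., 1), first column is (0, -1, ..., -1)ᵀ, and remaining (i,j)-block has entries (s_i - s_j)/(s_i + s_j), equals ∏_{1 ≤ i < j ≤ 2N-1} (s_i - s_j)/(s_i + s_j). -/
open Matrix

open Polynomial in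
theorem degree_C_mul_prod_X_add_C_lt {R : Type*} [CommRing R] [IsDomain R] {m : ℕ}
    (c : R) (r : Fin m → R) :
    (C c * ∏ k, (X + C (r k))).degree < ((m + 1 : ℕ) : WithBot ℕ) := by
  rw [← smul_eq_C_mul]
  refine lt_of_le_of_lt (degree_smul_le c _) ?_
  rw [degree_prod]
  simp only [degree_X_add_C, Finset.sum_const, Finset.card_univ, Fintype.card_fin, nsmul_eq_mul,
    mul_one]
  exact_mod_cast Nat.lt_succ_self m

/-- The product of `f i j` over the pairs `i < j`. -/
def pairProd {R : Type*} [CommRing R] {m : ℕ} (f : Fin m → Fin m → R) : R :=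
  ∏ i, ∏ j, if i < j then f i j else 1

theorem pairProd_succAbove {R : Type*} [CommRing R] {m : ℕ} (f : Fin (m + 1) → Fin (m + 1) → R)
    (c : R) (hf : ∀ i j, f i j = c * f j i) (p : Fin (m + 1)) :
    pairProd f = c ^ (p : ℕ) * (∏ k, f p (p.succAbove k)) *
      pairProd fun i j => f (p.succAbove i) (p.succAbove j) := by
  have hcard : ∏ k : Fin m, (if p.succAbove k < p then c else 1) = c ^ (p : ℕ) := by
    have h := Fin.prod_univ_succAbove (fun k => if k < p then c else (1 : R)) p
    simp only [lt_irrefl, if_false, one_mul] at h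
    rw [← h, Finset.prod_ite, Finset.prod_const, Finset.prod_const_one, mul_one]
    congr 1
    rw [Finset.filter_gt_eq_Iio, Fin.card_Iio]
  unfold pairProd
  rw [Fin.prod_univ_succAbove (fun i => ∏ j, if i < j then f i j else 1) p,
    Fin.prod_univ_succAbove (fun j => if p < j then f p j else 1) p]
  simp only [lt_irrefl, if_false, one_mul]
  simp only [Fin.prod_univ_succAbove _ p, Finset.prod_mul_distrib, Fin.succAbove_lt_succAbove_iff]
  simp only [← mul_assoc, ← hcard, ← Finset.prod_mul_distrib]
  refine Finset.prod_congr (M := R) rfl fun k _ => ?_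
  rcases lt_or_gt_of_ne (p.succAbove_ne k) with h | h
  · simp [h, h.not_gt, hf (p.succAbove k) p]
  · simp [h, h.not_gt]

theorem pairProd_div {K : Type*} [Field K] {m : ℕ} (f g : Fin m → Fin m → K) :
    pairProd (fun i j => f i j / g i j) = pairProd f / pairProd g := by
  simp only [pairProd, ← Finset.prod_div_distrib]
  refine Finset.prod_congr rfl fun i _ => Finset.prod_congr rfl fun j _ => ?_
  split_ifs <;> simp

theorem map_pairProd {R S : Type*} [CommRing R] [CommRing S] (φ : R →+* S) {m : ℕ}
    (f : Fin m → Fin m → R) : φ (pairProd f) = pairProd fun i j => φ (f i j) := by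
  simp only [pairProd, map_prod, apply_ite φ, map_one]

open Polynomial in
/-- Lagrange interpolation at the points `-s i`, for an odd number of variables. -/
theorem sum_alternating_pairProd_sub_of_injective {R : Type*} [CommRing R] [IsDomain R] {m : ℕ}
    (hm : Even m) (h2 : (2 : R) ≠ 0) (s : Fin (m + 1) → R) (hs : Function.Injective s)
    (hs0 : ∀ i, s i ≠ 0) (x : R) :
    ∑ j : Fin (m + 1), (-1) ^ (j : ℕ) * (x - s j) *
        ((∏ k, (x + s (j.succAbove k))) * (∏ k, (s j + s (j.succAbove k))) *
          pairProd fun a b => s (j.succAbove a) - s (j.succAbove b)) =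
      (∏ j, (x - s j)) * pairProd fun a b => s a - s b := by
  set V := pairProd fun a b => s a - s b with hV
  set A : Fin (m + 1) → R := fun j => (-1) ^ (j : ℕ) * (∏ k, (s j + s (j.succAbove k))) *
    pairProd fun a b => s (j.succAbove a) - s (j.succAbove b) with hA
  have hVA : ∀ j : Fin (m + 1), V = (-1) ^ (j : ℕ) * (∏ k, (s j - s (j.succAbove k))) *
      pairProd fun a b => s (j.succAbove a) - s (j.succAbove b) := fun j =>
    pairProd_succAbove (fun a b => s a - s b) (-1) (by intros; ring) j
  set κ := ∑ j, A j - V with hκ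
  have hprod : ∀ (y : R) (j : Fin (m + 1)),
      ∏ k, (y + s k) = (y + s j) * ∏ k, (y + s (j.succAbove k)) := fun y j =>
    Fin.prod_univ_succAbove _ j
  have hpoly : ∑ j, C (2 * s j * A j) * ∏ k, (X + C (s (j.succAbove k))) =
      C V * (∏ j, (X + C (s j)) - ∏ j, (X - C (s j))) := by
    have hinj : Set.InjOn (fun i => - s i) (Finset.univ : Finset (Fin (m + 1))) :=
      fun i _ j _ h => hs (neg_injective h)
    refine eq_of_degrees_lt_of_eval_index_eq Finset.univ hinj ?_ ?_ ?_
    · rw [Finset.card_univ, Fintype.card_fin]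
      rw [← mem_degreeLT]
      refine Submodule.sum_mem _ fun j _ => ?_
      rw [mem_degreeLT]
      exact degree_C_mul_prod_X_add_C_lt _ _
    · rw [Finset.card_univ, Fintype.card_fin]
      rw [← smul_eq_C_mul]
      refine lt_of_le_of_lt (degree_smul_le V _) ?_
      have hd : (∏ j, (X + C (s j))).degree = ((m + 1 : ℕ) : WithBot ℕ) := by
        rw [degree_prod]; simp
      have hd' : (∏ j, (X - C (s j))).degree = ((m + 1 : ℕ) : WithBot ℕ) := by
        rw [degree_prod]; simp
      have hmon : (∏ j, (X + C (s j))).Monic := monic_prod_of_monic _ _ fun j _ => monic_X_add_C _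
      have hmon' : (∏ j, (X - C (s j))).Monic := monic_prod_of_monic _ _ fun j _ => monic_X_sub_C _
      rw [← hd]
      exact degree_sub_lt_left (hd.trans hd'.symm) hmon.ne_zero (by rw [hmon, hmon'])
    · intro i _
      simp only [eval_finsetSum, eval_mul, eval_sub, eval_add, eval_prod, eval_C, eval_X]
      rw [Finset.sum_eq_single i]
      · have h0 : ∏ j, (-s i + s j) = 0 := by rw [hprod _ i]; simp
        have h1 : ∏ j, (-s i - s j) = -(2 * s i) * ∏ k, (s i + s (i.succAbove k)) := by
          rw [Fin.prod_univ_succAbove _ i]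
          have : ∏ k, (-s i - s (i.succAbove k)) = ∏ k, (s i + s (i.succAbove k)) := by
            have : ∀ k, -s i - s (i.succAbove k) = -(s i + s (i.succAbove k)) := by intro; ring
            simp only [this, Finset.prod_neg, Finset.card_univ, Fintype.card_fin, hm.neg_one_pow,
              one_mul]
          rw [this]; ring
        have h3 : ∏ k, (-s i + s (i.succAbove k)) = ∏ k, (s i - s (i.succAbove k)) := by
          have : ∀ k, -s i + s (i.succAbove k) = -(s i - s (i.succAbove k)) := by intro; ring
          simp only [this, Finset.prod_neg, Finset.card_univ, Fintype.card_fin, hm.neg_one_pow,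
            one_mul]
        rw [h0, h1, h3, hVA i, hA]
        ring
      · intro j _ hj
        obtain ⟨k, hk⟩ := Fin.exists_succAbove_eq hj.symm
        rw [Finset.prod_eq_zero (Finset.mem_univ k) (by rw [hk]; ring), mul_zero]
      · simp
  have hsum : ∀ y, ∑ j, A j * (y - s j) * ∏ k, (y + s (j.succAbove k)) =
      V * ∏ j, (y - s j) + κ * ∏ j, (y + s j) := by
    intro y
    have h := congrArg (eval y) hpoly
    simp only [eval_finsetSum, eval_mul, eval_sub, eval_add, eval_prod, eval_C, eval_X] at h
    have h' : ∑ j, A j * (y - s j) * ∏ k, (y + s (j.succAbove k)) =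
        (∑ j, A j) * ∏ j, (y + s j) -
          ∑ j, 2 * s j * A j * ∏ k, (y + s (j.succAbove k)) := by
      rw [Finset.sum_mul, ← Finset.sum_sub_distrib]
      refine Finset.sum_congr rfl fun j _ => ?_
      rw [hprod y j]; ring
    rw [h', h, hκ]; ring
  have hκ0 : κ = 0 := by
    have h := hsum 0
    have hl : ∑ j, A j * (0 - s j) * ∏ k, (0 + s (j.succAbove k)) =
        -((∑ j, A j) * ∏ j, s j) := by
      rw [Finset.sum_mul, ← Finset.sum_neg_distrib]
      refine Finset.sum_congr rfl fun j _ => ?_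
      rw [Fin.prod_univ_succAbove s j]; simp only [zero_add]; ring
    have hr : ∏ j, (0 - s j) = -∏ j, s j := by
      simp only [zero_sub, Finset.prod_neg, Finset.card_univ, Fintype.card_fin,
        hm.add_one.neg_one_pow, neg_one_mul]
    rw [hl, hr] at h
    simp only [zero_add] at h
    have h4 : 2 * κ * ∏ j, s j = 0 := by linear_combination -h + (∏ j, s j) * hκ
    have h5 : ∏ j, s j ≠ 0 := Finset.prod_ne_zero_iff.2 fun j _ => hs0 j
    simpa [h2, h5] using h4
  have h := hsum x
  rw [hκ0, zero_mul, add_zero, mul_comm] at h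
  rw [← h]
  refine Finset.sum_congr rfl fun j _ => ?_
  rw [hA]; ring

theorem sum_alternating_pairProd_sub {R : Type*} [CommRing R] {m : ℕ}
    (hm : Even m) (s : Fin (m + 1) → R) (x : R) :
    ∑ j : Fin (m + 1), (-1) ^ (j : ℕ) * (x - s j) *
        ((∏ k, (x + s (j.succAbove k))) * (∏ k, (s j + s (j.succAbove k))) *
          pairProd fun a b => s (j.succAbove a) - s (j.succAbove b)) =
      (∏ j, (x - s j)) * pairProd fun a b => s a - s b := by
  have h := sum_alternating_pairProd_sub_of_injective
    (R := MvPolynomial (Option (Fin (m + 1))) ℤ) hm two_ne_zero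
    (fun i => MvPolynomial.X (some i))
    (fun i j hij => Option.some_injective _ (MvPolynomial.X_injective hij))
    (fun i => MvPolynomial.X_ne_zero _) (MvPolynomial.X none)
  have h' := congrArg
    (MvPolynomial.eval₂Hom (Int.castRingHom R) fun o : Option (Fin (m + 1)) => o.elim x s) h
  simpa [map_pairProd, -MvPolynomial.coe_eval₂Hom, MvPolynomial.eval₂Hom_X'] using h'

theorem sum_alternating_pairProd_div {K : Type*} [Field K] {m : ℕ} (hm : Even m)
    (s : Fin (m + 1) → K) (hs : ∀ i j, s i + s j ≠ 0) (x : K) (hx : ∀ i, x + s i ≠ 0) :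
    ∑ j : Fin (m + 1), (-1) ^ (j : ℕ) * ((x - s j) / (x + s j)) *
        (pairProd fun a b => (s (j.succAbove a) - s (j.succAbove b)) /
          (s (j.succAbove a) + s (j.succAbove b))) =
      (∏ j, (x - s j) / (x + s j)) * pairProd fun a b => (s a - s b) / (s a + s b) := by
  have hne : ∀ {l : ℕ} (r : Fin l → Fin (m + 1)),
      (pairProd fun a b => s (r a) + s (r b)) ≠ 0 := by
    intro l r
    refine Finset.prod_ne_zero_iff.2 fun i _ => Finset.prod_ne_zero_iff.2 fun j _ => ?_
    split_ifs
    · exact hs _ _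
    · exact one_ne_zero
  have hW : (pairProd fun a b => s a + s b) ≠ 0 := hne id
  have hX : ∏ j, (x + s j) ≠ 0 := Finset.prod_ne_zero_iff.2 fun j _ => hx j
  rw [pairProd_div, Finset.prod_div_distrib, div_mul_div_comm, ← sum_alternating_pairProd_sub hm,
    Finset.sum_div]
  refine Finset.sum_congr rfl fun j _ => ?_
  have hWj := pairProd_succAbove (fun a b => s a + s b) 1 (by intros; ring) j
  rw [one_pow, one_mul] at hWj
  rw [pairProd_div, hWj, Fin.prod_univ_succAbove _ j]
  have h1 := hne j.succAbove
  have h2 : ∏ k, (x + s (j.succAbove k)) ≠ 0 := Finset.prod_ne_zero_iff.2 fun k _ => hx _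
  have h3 : ∏ k, (s j + s (j.succAbove k)) ≠ 0 := Finset.prod_ne_zero_iff.2 fun k _ => hs _ _
  have h4 := hx j
  field_simp

/-- Schur's Pfaffian identity for an even number of variables. -/
theorem schur_pfaffian_even {K : Type*} [Field K] (n : ℕ)
    (s : Fin (2 * n) → K) (hs : ∀ i j, s i + s j ≠ 0) :
    pf (2 * n) (Matrix.of fun i j => (s i - s j) / (s i + s j)) =
      pairProd fun i j => (s i - s j) / (s i + s j) := by
  induction n with
  | zero => simp [pf, pairProd]
  | succ n ih =>
    suffices h : ∀ s : Fin (2 * n + 2) → K, (∀ i j, s i + s j ≠ 0) →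
        pf (2 * n + 2) (Matrix.of fun i j => (s i - s j) / (s i + s j)) =
          pairProd fun i j => (s i - s j) / (s i + s j) from h s hs
    intro s hs
    rw [pf, pairProd_succAbove (fun i j => (s i - s j) / (s i + s j)) (-1) ?_ 0]
    · simp only [Fin.val_zero, pow_zero, one_mul, Fin.succAbove_zero]
      rw [← sum_alternating_pairProd_div (even_two_mul n) (fun i => s i.succ)
        (fun i j => hs _ _) (s 0) (fun i => hs _ _)]
      refine Finset.sum_congr rfl fun j _ => ?_
      rw [← ih (fun i => s (j.succAbove i).succ) fun i j => hs _ _]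
      rfl
    · intro i j
      rw [add_comm (s j), neg_one_mul, ← neg_div, neg_sub]

/-- Schur's Pfaffian identity, odd case: the Pfaffian of the
`(2N) × (2N)` (here `2N = 2n+2`) skew-symmetric matrix whose first row is
`(0, 1, ..., 1)`, first column `(0, -1, ..., -1)ᵀ`, and whose remaining block
has entries `(sᵢ - sⱼ)/(sᵢ + sⱼ)` for `s : Fin (2n+1) → K`, equals
`∏_{i<j} (sᵢ - sⱼ)/(sᵢ + sⱼ)`. -/
theorem schur_pfaffian_odd {K : Type*} [Field K] (n : ℕ)
    (s : Fin (2 * n + 1) → K) (hs : ∀ i j, s i + s j ≠ 0) :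
    pf (2 * n + 1 + 1) (Matrix.of fun i j : Fin (2 * n + 1 + 1) =>
        if (i : ℕ) = 0 then (if (j : ℕ) = 0 then 0 else 1)
        else if (j : ℕ) = 0 then -1
        else (s ⟨(i : ℕ) - 1, by have := i.isLt; omega⟩
                - s ⟨(j : ℕ) - 1, by have := j.isLt; omega⟩) /
             (s ⟨(i : ℕ) - 1, by have := i.isLt; omega⟩
                + s ⟨(j : ℕ) - 1, by have := j.isLt; omega⟩))
      = ∏ i : Fin (2 * n + 1), ∏ j : Fin (2 * n + 1),
          if i < j then (s i - s j) / (s i + s j) else 1 := by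
  have hs0 : ∀ i, s i ≠ 0 := fun i h => hs i i (by rw [h, add_zero])
  have key := sum_alternating_pairProd_div (even_two_mul n) s hs 0
    fun i => by rw [zero_add]; exact hs0 i
  have hdiv : ∀ j, (0 - s j) / (0 + s j) = -1 := fun j => by
    rw [zero_sub, zero_add, neg_div, div_self (hs0 j)]
  simp only [hdiv, Finset.prod_const, Finset.card_univ, Fintype.card_fin,
    (even_two_mul n).add_one.neg_one_pow, mul_neg, mul_one, neg_mul, one_mul,
    Finset.sum_neg_distrib, neg_inj] at key
  change _ = pairProd fun a b => (s a - s b) / (s a + s b)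
  rw [← key, pf]
  refine Finset.sum_congr rfl fun j _ => ?_
  rw [← schur_pfaffian_even n (fun i => s (j.succAbove i)) fun i j => hs _ _]
  simp only [Matrix.of_apply, Fin.val_zero, if_true, Fin.val_succ, Nat.succ_ne_zero, if_false,
    mul_one]
  congr 1
end

section
/- (Pfaffian bilinear identity, odd version) For skew-symmetric Pfaffian entries on {a_1,a_2,a_3} ∪ {1,...,2N}: Pf(a_1,a_2,a_3,1,...,2N-1)·Pf(1,...,2N) = Pf(a_1,1,...,2N-1)·Pf(a_2,a_3,1,...,2N) - Pf(a_2,1,...,2N-1)·Pf(a_1,a_3,1,...,2N) + Pf(a_3,1,...,2N-1)·Pf(a_1,a_2,1,...,2N). -/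
open Matrix

/-- The Pfaffian of the skew-symmetric matrix whose `(k,l)` entry is
`P (v k) (v l)` for a list of indices `v`. -/
def pfIdx {R : Type*} [CommRing R] {ι : Type*} (P : ι → ι → R) {m : ℕ}
    (v : Fin m → ι) : R :=
  pf m (Matrix.of fun k l => P (v k) (v l))

section Expansion

variable {R : Type*} [CommRing R] {ι : Type*}

theorem pf_congr_of_lt : ∀ {n : ℕ} {M N : Matrix (Fin n) (Fin n) R},
    (∀ i j, i < j → M i j = N i j) → pf n M = pf n N
  | 0, _, _, _ => rfl
  | 1, _, _, _ => rfl
  | n + 2, M, N, h => by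
    simp only [pf]
    refine Finset.sum_congr rfl fun j _ => ?_
    rw [h 0 j.succ (Fin.succ_pos j)]
    congr 1
    refine pf_congr_of_lt fun a b hab => h _ _ ?_
    exact Fin.succ_lt_succ_iff.2 (Fin.strictMono_succAbove j hab)

theorem pfIdx_cons (P : ι → ι → R) {n : ℕ} (x : ι) (v : Fin (n + 1) → ι) :
    pfIdx P (Fin.cons x v : Fin (n + 2) → ι) =
      ∑ j : Fin (n + 1), (-1 : R) ^ (j : ℕ) * P x (v j) * pfIdx P (v ∘ j.succAbove) :=
  rfl

theorem pfIdx_eq_of_cast (P : ι → ι → R) {m n : ℕ} (h : m = n) {u : Fin m → ι} {v : Fin n → ι}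
    (huv : ∀ i, u i = v (Fin.cast h i)) : pfIdx P u = pfIdx P v := by
  subst h
  exact congrArg _ (funext huv)

theorem pfIdx_append_one (P : ι → ι → R) (a : ι) {m : ℕ} (v : Fin m → ι) :
    pfIdx P (Fin.append ![a] v) = pfIdx P (Fin.cons a v : Fin (m + 1) → ι) := by
  refine pfIdx_eq_of_cast P (Nat.add_comm _ _) (Fin.addCases (fun i => ?_) fun i => ?_)
  · rw [Fin.append_left]
    fin_cases i
    rfl
  · rw [Fin.append_right, show Fin.cast _ (Fin.natAdd 1 i) = i.succ by ext; simp]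
    rfl

theorem pfIdx_append_two (P : ι → ι → R) (a b : ι) {m : ℕ} (v : Fin m → ι) :
    pfIdx P (Fin.append ![a, b] v) =
      pfIdx P (Fin.cons a (Fin.cons b v : Fin (m + 1) → ι) : Fin (m + 2) → ι) := by
  refine pfIdx_eq_of_cast P (Nat.add_comm _ _) (Fin.addCases (fun i => ?_) fun i => ?_)
  · rw [Fin.append_left]
    fin_cases i <;> rfl
  · rw [Fin.append_right, show Fin.cast _ (Fin.natAdd 2 i) = i.succ.succ by ext; simp]
    rfl

theorem pfIdx_append_three (P : ι → ι → R) (a b c : ι) {m : ℕ} (v : Fin m → ι) :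
    pfIdx P (Fin.append ![a, b, c] v) =
      pfIdx P (Fin.cons a (Fin.cons b (Fin.cons c v : Fin (m + 1) → ι) : Fin (m + 2) → ι)
        : Fin (m + 3) → ι) := by
  refine pfIdx_eq_of_cast P (Nat.add_comm _ _) (Fin.addCases (fun i => ?_) fun i => ?_)
  · rw [Fin.append_left]
    fin_cases i <;> rfl
  · rw [Fin.append_right,
      show Fin.cast _ (Fin.natAdd 3 i) = i.succ.succ.succ by ext; simp]
    rfl

/-- Exchanging the two expansions of the double sum
`∑ i j, ± P (v i) (w j) * Pf (v without v i) * Pf (w without w j)`. -/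
theorem sum_pfIdx_mul_pfIdx_cons {P : ι → ι → R} (hP : ∀ x y, P x y = -P y x) {m k : ℕ}
    (v : Fin (m + 1) → ι) (w : Fin (k + 1) → ι) :
    ∑ i : Fin (m + 1), (-1 : R) ^ (i : ℕ) * pfIdx P (Fin.cons (v i) w : Fin (k + 2) → ι) *
        pfIdx P (v ∘ i.succAbove) =
      -∑ j : Fin (k + 1), (-1 : R) ^ (j : ℕ) * pfIdx P (Fin.cons (w j) v : Fin (m + 2) → ι) *
        pfIdx P (w ∘ j.succAbove) := by
  simp only [pfIdx_cons, Finset.mul_sum, Finset.sum_mul]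
  rw [Finset.sum_comm, ← Finset.sum_neg_distrib]
  refine Finset.sum_congr rfl fun j _ => ?_
  rw [← Finset.sum_neg_distrib]
  refine Finset.sum_congr rfl fun i _ => ?_
  rw [hP (v i) (w j)]
  ring

end Expansion

section Alternating

variable {R : Type*} [CommRing R] {M : Type*} [AddCommGroup M] [Module R M]

theorem contractLeft_ιMulti_succ (d : Module.Dual R M) :
    ∀ {n : ℕ} (v : Fin (n + 1) → M),
      CliffordAlgebra.contractLeft (Q := (0 : QuadraticForm R M)) d
          (ExteriorAlgebra.ιMulti R (n + 1) v) =
        ∑ j : Fin (n + 1), ((-1 : R) ^ (j : ℕ) * d (v j)) •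
          ExteriorAlgebra.ιMulti R n (v ∘ j.succAbove)
  | 0, v => by
    rw [ExteriorAlgebra.ιMulti_succ_apply]
    erw [CliffordAlgebra.contractLeft_ι_mul]
    simp
  | n + 1, v => by
    rw [ExteriorAlgebra.ιMulti_succ_apply]
    erw [CliffordAlgebra.contractLeft_ι_mul]
    rw [contractLeft_ιMulti_succ d (Matrix.vecTail v), Fin.sum_univ_succ (n := n + 1), Finset.mul_sum,
      sub_eq_add_neg, ← Finset.sum_neg_distrib]
    congr 1
    · simp [Matrix.vecTail]
    · refine Finset.sum_congr rfl fun j _ => ?_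
      rw [ExteriorAlgebra.ιMulti_succ_apply (v ∘ j.succ.succAbove), mul_smul_comm, ← neg_smul]
      have hv : Matrix.vecTail (v ∘ j.succ.succAbove) = Matrix.vecTail v ∘ j.succAbove := by
        funext i
        simp [Matrix.vecTail]
      rw [hv]
      congr 1
      simp [Matrix.vecTail, pow_succ]

/-- The Pfaffian of an alternating form is an alternating multilinear map. -/
theorem exists_alternatingMap_pfIdx {B : LinearMap.BilinForm R M} (hB : B.IsAlt) (n : ℕ) :
    ∃ F : M [⋀^Fin n]→ₗ[R] R, ∀ v, F v = pfIdx (fun x y => B x y) v := by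
  have h : (-B).toQuadraticMap = (0 : QuadraticForm R M) - 0 := by
    ext x
    simp [hB x]
  let E : ExteriorAlgebra R M →ₗ[R] R :=
    ExteriorAlgebra.algebraMapInv.toLinearMap ∘ₗ CliffordAlgebra.changeForm h
  have hE (x : M) (y : ExteriorAlgebra R M) : E (ExteriorAlgebra.ι R x * y) =
      E (CliffordAlgebra.contractLeft (Q := (0 : QuadraticForm R M)) (B x) y) := by
    have h1 : CliffordAlgebra.changeForm h (ExteriorAlgebra.ι R x * y) =
        ExteriorAlgebra.ι R x * CliffordAlgebra.changeForm h y +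
          CliffordAlgebra.changeForm h (CliffordAlgebra.contractLeft (B x) y) := by
      rw [CliffordAlgebra.changeForm_contractLeft]
      erw [CliffordAlgebra.changeForm_ι_mul]
      simp
    simp only [E, LinearMap.comp_apply]
    rw [h1, map_add]
    simp [ExteriorAlgebra.algebraMapInv]
  refine ⟨E.compAlternatingMap (ExteriorAlgebra.ιMulti R n), ?_⟩
  simp only [LinearMap.compAlternatingMap_apply]
  induction n using Nat.twoStepInduction with
  | zero =>
    intro v
    simp only [ExteriorAlgebra.ιMulti_zero_apply, E, LinearMap.comp_apply]
    erw [CliffordAlgebra.changeForm_one]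
    simp [pfIdx, pf]
  | one =>
    intro v
    rw [ExteriorAlgebra.ιMulti_succ_apply, hE, ExteriorAlgebra.ιMulti_zero_apply]
    erw [CliffordAlgebra.contractLeft_one]
    simp [pfIdx, pf]
  | more n ih _ =>
    intro v
    rw [ExteriorAlgebra.ιMulti_succ_apply, hE, contractLeft_ιMulti_succ, map_sum]
    simp only [map_smul, smul_eq_mul, ih]
    exact (pfIdx_cons (fun x y => B x y) (v 0) (Matrix.vecTail v)).symm.trans
      (congrArg _ (Fin.cons_self_tail v))

variable {κ : Type*} [Fintype κ] [DecidableEq κ] {A : κ → κ → R}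

theorem exists_alternatingMap_pfIdx_of_matrix (hA : ∀ x y, A x y = -A y x)
    (hA0 : ∀ x, A x x = 0) (n : ℕ) :
    ∃ F : (κ → R) [⋀^Fin n]→ₗ[R] R, ∀ v : Fin n → κ,
      F (fun i => Pi.single (v i) 1) = pfIdx A v := by
  have hB : (Matrix.toBilin' (Matrix.of A)).IsAlt := by
    intro x
    rw [Matrix.toBilin'_apply]
    rw [← Finset.sum_product']
    refine Finset.sum_involution (fun p _ => p.swap) ?_ ?_ (by simp) (by simp)
    · intro p _
      simp only [Matrix.of_apply, Prod.fst_swap, Prod.snd_swap]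
      rw [hA p.1 p.2]
      ring
    · rintro ⟨a, b⟩ _ h hab
      obtain rfl : b = a := congrArg Prod.fst hab
      simp [hA0] at h
  obtain ⟨F, hF⟩ := exists_alternatingMap_pfIdx hB n
  refine ⟨F, fun v => ?_⟩
  rw [hF]
  simp [pfIdx, Matrix.toBilin'_single]

theorem pfIdx_eq_zero_of_not_injective (hA : ∀ x y, A x y = -A y x) (hA0 : ∀ x, A x x = 0)
    {n : ℕ} {v : Fin n → κ} (hv : ¬Function.Injective v) : pfIdx A v = 0 := by
  obtain ⟨F, hF⟩ := exists_alternatingMap_pfIdx_of_matrix hA hA0 n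
  rw [← hF]
  refine F.map_eq_zero_of_not_injective _ fun h => hv ?_
  exact Function.Injective.of_comp (f := fun k : κ => (Pi.single k 1 : κ → R)) h

theorem pfIdx_comp_perm (hA : ∀ x y, A x y = -A y x) (hA0 : ∀ x, A x x = 0)
    {n : ℕ} (v : Fin n → κ) (σ : Equiv.Perm (Fin n)) :
    pfIdx A (v ∘ σ) = Equiv.Perm.sign σ • pfIdx A v := by
  obtain ⟨F, hF⟩ := exists_alternatingMap_pfIdx_of_matrix hA hA0 n
  rw [← hF, ← hF]
  exact F.map_perm (fun i => Pi.single (v i) 1) σ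

theorem pfIdx_snoc (hA : ∀ x y, A x y = -A y x) (hA0 : ∀ x, A x x = 0)
    {n : ℕ} (v : Fin n → κ) (x : κ) :
    pfIdx A (Fin.snoc v x : Fin (n + 1) → κ) =
      (-1) ^ n * pfIdx A (Fin.cons x v : Fin (n + 1) → κ) := by
  rw [Fin.snoc_eq_cons_rotate]
  refine (pfIdx_comp_perm hA hA0 (Fin.cons x v : Fin (n + 1) → κ) (finRotate _)).trans ?_
  rw [sign_finRotate]
  simp [Units.smul_def]

end Alternating

/-- The identity for the universal list of indices `0, 1, …, 2n+4`. -/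
theorem pfIdx_bilinear_identity_fin {R : Type*} [CommRing R] {n : ℕ}
    {A : Fin (2 * n + 5) → Fin (2 * n + 5) → R}
    (hA : ∀ x y, A x y = -A y x) (hA0 : ∀ x, A x x = 0)
    {s : Fin (2 * n + 1 + 1) → Fin (2 * n + 5)} (hs : s = fun i => i.succ.succ.succ) :
    pfIdx A (Fin.cons 0 (Fin.cons 1 (Fin.cons 2 (Fin.init s)
        : Fin (2 * n + 2) → _) : Fin (2 * n + 3) → _) : Fin (2 * n + 4) → _) * pfIdx A s =
      pfIdx A (Fin.cons 0 (Fin.init s) : Fin (2 * n + 2) → _) *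
          pfIdx A (Fin.cons 1 (Fin.cons 2 s : Fin (2 * n + 3) → _) : Fin (2 * n + 4) → _)
        - pfIdx A (Fin.cons 1 (Fin.init s) : Fin (2 * n + 2) → _) *
          pfIdx A (Fin.cons 0 (Fin.cons 2 s : Fin (2 * n + 3) → _) : Fin (2 * n + 4) → _)
        + pfIdx A (Fin.cons 2 (Fin.init s) : Fin (2 * n + 2) → _) *
          pfIdx A (Fin.cons 0 (Fin.cons 1 s : Fin (2 * n + 3) → _) : Fin (2 * n + 4) → _) := by
  have key := sum_pfIdx_mul_pfIdx_cons hA (Fin.init s) (id : Fin (2 * n + 5) → _)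
  rw [Finset.sum_eq_zero fun i _ => ?_, Fin.sum_univ_succ, Fin.sum_univ_succ, Fin.sum_univ_succ,
    Fin.sum_univ_castSucc, Finset.sum_eq_zero fun i _ => ?_] at key
  · have hlast : pfIdx A (Fin.cons (s (Fin.last _)) (Fin.init s) : Fin (2 * n + 2) → _) =
        -pfIdx A s := by
      have h := pfIdx_snoc hA hA0 (Fin.init s) (s (Fin.last _))
      rw [Fin.snoc_init_self, Odd.neg_one_pow ⟨n, rfl⟩] at h
      rw [h]
      ring
    have e0 : (id ∘ (0 : Fin (2 * n + 5)).succAbove) =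
        (Fin.cons 1 (Fin.cons 2 s : Fin (2 * n + 3) → _) : Fin (2 * n + 4) → _) := by
      subst hs
      funext i
      refine Fin.cases ?_ (fun i => Fin.cases ?_ (fun i => ?_) i) i <;> simp
    have e1 : (id ∘ (Fin.succ 0 : Fin (2 * n + 5)).succAbove) =
        (Fin.cons 0 (Fin.cons 2 s : Fin (2 * n + 3) → _) : Fin (2 * n + 4) → _) := by
      subst hs
      funext i
      refine Fin.cases ?_ (fun i => Fin.cases ?_ (fun i => ?_) i) i <;> simp
    have e2 : (id ∘ (Fin.succ (Fin.succ 0) : Fin (2 * n + 5)).succAbove) =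
        (Fin.cons 0 (Fin.cons 1 s : Fin (2 * n + 3) → _) : Fin (2 * n + 4) → _) := by
      subst hs
      funext i
      refine Fin.cases ?_ (fun i => Fin.cases ?_ (fun i => ?_) i) i <;> (simp; rfl)
    have e3 : (id ∘ (Fin.succ (Fin.succ (Fin.succ (Fin.last (2 * n + 1)))) :
          Fin (2 * n + 5)).succAbove) =
        (Fin.cons 0 (Fin.cons 1 (Fin.cons 2 (Fin.init s)
          : Fin (2 * n + 2) → _) : Fin (2 * n + 3) → _) : Fin (2 * n + 4) → _) := by
      subst hs
      funext i
      refine Fin.cases ?_ (fun i => Fin.cases ?_ (fun i => Fin.cases ?_ (fun i => ?_) i) i) i <;>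
        simp [Fin.init]
      rfl
    have hl : id (Fin.succ (Fin.succ (Fin.succ (Fin.last (2 * n + 1))))) = s (Fin.last _) := by
      rw [hs]
      rfl
    rw [e0, e1, e2, e3, hl, hlast] at key
    have hpow : (-1 : R) ^ (2 * n + 1 + 1 + 1 + 1) = 1 := Even.neg_one_pow ⟨n + 2, by ring⟩
    simp only [Fin.val_succ, Fin.val_last, Fin.val_zero, hpow, id_eq, Fin.succ_zero_eq_one,
      Fin.succ_one_eq_two, show ((1 : Fin (2 * n + 5)) : ℕ) = 1 from rfl,
      show ((2 : Fin (2 * n + 5)) : ℕ) = 2 from rfl] at key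
    linear_combination -key
  · rw [pfIdx_eq_zero_of_not_injective hA hA0 (v := Fin.cons _ _), mul_zero, zero_mul]
    intro h
    have := @h 0 i.succ (by simp [hs, Fin.init])
    exact absurd this (Fin.succ_ne_zero i).symm
  · rw [pfIdx_eq_zero_of_not_injective hA hA0 (v := Fin.cons _ _), mul_zero, zero_mul]
    intro h
    have := @h 0 (Fin.succ (Fin.init s i)) (by simp)
    exact absurd this (Fin.succ_ne_zero _).symm

/-- Pfaffian bilinear identity, odd version: with `2N = 2n+2`
(indices `1,…,2N` given by `idx` and `1,…,2N-1` by `Fin.init idx`),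
`Pf(a₁,a₂,a₃,1,…,2N-1)·Pf(1,…,2N)
 = Σⱼ (-1)^{j-1} Pf(aⱼ,1,…,2N-1)·Pf(a₁,…,âⱼ,…,a₃,1,…,2N)`. -/
theorem pf_bilinear_identity_odd {R : Type*} [CommRing R] {ι : Type*} (n : ℕ)
    (P : ι → ι → R) (hP : ∀ x y, P x y = - P y x)
    (a1 a2 a3 : ι) (idx : Fin (2 * n + 1 + 1) → ι) :
    pfIdx P (Fin.append ![a1, a2, a3] (Fin.init idx)) * pfIdx P idx
      = pfIdx P (Fin.append ![a1] (Fin.init idx)) * pfIdx P (Fin.append ![a2, a3] idx)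
        - pfIdx P (Fin.append ![a2] (Fin.init idx)) * pfIdx P (Fin.append ![a1, a3] idx)
        + pfIdx P (Fin.append ![a3] (Fin.init idx)) * pfIdx P (Fin.append ![a1, a2] idx) := by
  let w : Fin (2 * n + 5) → ι := Fin.cons a1 (Fin.cons a2 (Fin.cons a3 idx
    : Fin (2 * n + 3) → ι) : Fin (2 * n + 4) → ι)
  let A : Fin (2 * n + 5) → Fin (2 * n + 5) → R := fun k l => if k = l then 0 else P (w k) (w l)
  have hA : ∀ x y, A x y = -A y x := by
    intro x y
    simp only [A, eq_comm (a := y)]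
    split_ifs
    · simp
    · exact hP _ _
  have hA0 : ∀ x, A x x = 0 := fun x => if_pos rfl
  have hw {m : ℕ} (t : Fin m → Fin (2 * n + 5)) (ht : Function.Injective t) :
      pfIdx A t = pfIdx P (w ∘ t) :=
    pf_congr_of_lt fun i j hij => if_neg (ht.ne hij.ne)
  have key := pfIdx_bilinear_identity_fin hA hA0 rfl
  have hs : Function.Injective fun i : Fin (2 * n + 1 + 1) => i.succ.succ.succ :=
    fun i j h => by simpa using h
  have hs' : Function.Injective (Fin.init fun i : Fin (2 * n + 1 + 1) => i.succ.succ.succ) :=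
    fun i j h => by simpa [Fin.init] using h
  have h02 : (0 : Fin (2 * n + 5)) ≠ 2 := Fin.ne_of_val_ne (show 0 ≠ 2 by omega)
  have h12 : (1 : Fin (2 * n + 5)) ≠ 2 := Fin.ne_of_val_ne (show 1 ≠ 2 by omega)
  have hne1 (i : Fin (2 * n + 2)) : i.succ.succ.succ ≠ 1 :=
    Fin.ne_of_val_ne (show (i : ℕ) + 3 ≠ 1 by omega)
  have hne2 (i : Fin (2 * n + 2)) : i.succ.succ.succ ≠ 2 :=
    Fin.ne_of_val_ne (show (i : ℕ) + 3 ≠ 2 by omega)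
  rw [hw, hw, hw, hw, hw, hw, hw, hw] at key
  · rw [pfIdx_append_one, pfIdx_append_one, pfIdx_append_one, pfIdx_append_two,
      pfIdx_append_two, pfIdx_append_two, pfIdx_append_three]
    have hc {m : ℕ} (k : Fin (2 * n + 5)) (t : Fin m → Fin (2 * n + 5)) :
        w ∘ (Fin.cons k t : Fin (m + 1) → _) = (Fin.cons (w k) (w ∘ t) : Fin (m + 1) → ι) :=
      Fin.comp_cons w k t
    simp only [hc] at key
    exact key
  · simp [Fin.cons_injective_iff, hs, hne1]
  · simp [Fin.cons_injective_iff, hs', Fin.init, hne2]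
  · simp [Fin.cons_injective_iff, hs, h02, hne2]
  · simp [Fin.cons_injective_iff, hs', Fin.init, hne1]
  · simp [Fin.cons_injective_iff, hs, h12, hne1, hne2]
  · simp [Fin.cons_injective_iff, hs', Fin.init]
  · exact hs
  · simp [Fin.cons_injective_iff, hs', h02, h12, Fin.init, hne1, hne2]
end

section
/- (de Bruijn quaternionic-type formula) Let φ_i, ψ_i (i = 1,...,2N) be integrable functions on [a,b]. Then ∫_a^b ⋯ ∫_a^b det[φ_i(x_j), ψ_i(x_j)]_{i=1..2N; j=1..N} dx_1⋯dx_N = N! · Pf(M), where M is the 2N×2N skew-symmetric matrix with M_{i,j} = ∫_a^b (φ_i(x)ψ_j(x) - φ_j(x)ψ_i(x)) dx. -/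
open Matrix

open MeasureTheory

/-- The even index `2k` of the `k`-th pair. -/
def pairFst {N : ℕ} (k : Fin N) : Fin (2 * N) := ⟨2 * k, by omega⟩

/-- The odd index `2k + 1` of the `k`-th pair. -/
def pairSnd {N : ℕ} (k : Fin N) : Fin (2 * N) := ⟨2 * k + 1, by omega⟩

lemma pairFst_inj {N : ℕ} {k l : Fin N} : pairFst k = pairFst l ↔ k = l := by
  simp only [pairFst, Fin.ext_iff]; omega

lemma pairSnd_inj {N : ℕ} {k l : Fin N} : pairSnd k = pairSnd l ↔ k = l := by
  simp only [pairSnd, Fin.ext_iff]; omega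

lemma pairFst_ne_pairSnd {N : ℕ} (k l : Fin N) : pairFst k ≠ pairSnd l := by
  simp only [pairFst, pairSnd, ne_eq, Fin.ext_iff]; omega

lemma exists_eq_pairFst_or_eq_pairSnd {N : ℕ} (c : Fin (2 * N)) :
    ∃ k : Fin N, c = pairFst k ∨ c = pairSnd k := by
  refine ⟨⟨c / 2, by omega⟩, ?_⟩
  simp only [pairFst, pairSnd, Fin.ext_iff]
  omega

lemma prod_eq_prod_pairs {R : Type*} [CommMonoid R] {N : ℕ} (f : Fin (2 * N) → R) :
    ∏ c, f c = ∏ k : Fin N, f (pairFst k) * f (pairSnd k) := by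
  rw [← (finProdFinEquiv.trans (finCongr (Nat.mul_comm N 2))).prod_comp f,
    Fintype.prod_prod_type]
  refine Finset.prod_congr rfl fun k _ => ?_
  rw [Fin.prod_univ_two]
  congr 2 <;> ext <;> simp [finProdFinEquiv, pairFst, pairSnd] <;> omega

/-- One term of the signed sum of products over consecutive pairs. -/
def pairTerm {R : Type*} [CommRing R] {N : ℕ} (g : Fin N → Matrix (Fin (2 * N)) (Fin (2 * N)) R)
    (σ : Equiv.Perm (Fin (2 * N))) : R :=
  (Equiv.Perm.sign σ : ℤ) * ∏ k, g k (σ (pairFst k)) (σ (pairSnd k))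

section Pairs

variable {R : Type*} [CommRing R] {N : ℕ}

lemma swap_pair_apply_of_ne {k l : Fin N} (h : l ≠ k) :
    Equiv.swap (pairFst k) (pairSnd k) (pairFst l) = pairFst l ∧
      Equiv.swap (pairFst k) (pairSnd k) (pairSnd l) = pairSnd l :=
  ⟨Equiv.swap_apply_of_ne_of_ne (by rwa [ne_eq, pairFst_inj]) (pairFst_ne_pairSnd _ _),
    Equiv.swap_apply_of_ne_of_ne (pairFst_ne_pairSnd _ _).symm (by rwa [ne_eq, pairSnd_inj])⟩

lemma pairTerm_mul_swap (g : Fin N → Matrix (Fin (2 * N)) (Fin (2 * N)) R) (k : Fin N)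
    (σ : Equiv.Perm (Fin (2 * N))) :
    pairTerm g (σ * Equiv.swap (pairFst k) (pairSnd k)) =
      -pairTerm (Function.update g k (g k).transpose) σ := by
  unfold pairTerm
  rw [Equiv.Perm.sign_mul, Equiv.Perm.sign_swap (pairFst_ne_pairSnd _ _)]
  push_cast
  rw [mul_neg_one, neg_mul]
  congr 2
  refine Finset.prod_congr rfl fun l _ => ?_
  rcases eq_or_ne l k with rfl | h
  · simp
  · simp [h, swap_pair_apply_of_ne h]

lemma sum_pairTerm_update_sub_transpose
    (g : Fin N → Matrix (Fin (2 * N)) (Fin (2 * N)) R) (k : Fin N) :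
    ∑ σ, pairTerm (Function.update g k (g k - (g k).transpose)) σ = 2 * ∑ σ, pairTerm g σ := by
  have hsplit (σ) : pairTerm (Function.update g k (g k - (g k).transpose)) σ =
      pairTerm g σ - pairTerm (Function.update g k (g k).transpose) σ := by
    have hprod (A : Matrix (Fin (2 * N)) (Fin (2 * N)) R) :
        ∏ l, Function.update g k A l (σ (pairFst l)) (σ (pairSnd l)) =
          A (σ (pairFst k)) (σ (pairSnd k)) *
            ∏ l ∈ Finset.univ.erase k, g l (σ (pairFst l)) (σ (pairSnd l)) := by
      rw [← Finset.mul_prod_erase _ _ (Finset.mem_univ k), Function.update_self]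
      congr 1
      refine Finset.prod_congr rfl fun l hl => ?_
      rw [Function.update_of_ne (Finset.ne_of_mem_erase hl)]
    have hg := hprod (g k)
    rw [Function.update_eq_self] at hg
    unfold pairTerm
    rw [hprod, hprod, hg, Matrix.sub_apply]
    ring
  have hneg (σ) : pairTerm (Function.update g k (g k - (g k).transpose)) σ =
      pairTerm g σ + pairTerm g (σ * Equiv.swap (pairFst k) (pairSnd k)) := by
    rw [hsplit, pairTerm_mul_swap, sub_eq_add_neg]
  simp_rw [hneg]
  rw [Finset.sum_add_distrib]
  refine Eq.trans ?_ (two_mul _).symm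
  congr 1
  exact Equiv.sum_comp (Equiv.mulRight (Equiv.swap (pairFst k) (pairSnd k))) (pairTerm g)

lemma sum_pairTerm_sub_transpose (g : Fin N → Matrix (Fin (2 * N)) (Fin (2 * N)) R) :
    ∑ σ, pairTerm (fun k => g k - (g k).transpose) σ = 2 ^ N * ∑ σ, pairTerm g σ := by
  have key (s : Finset (Fin N)) :
      ∑ σ, pairTerm (fun k => if k ∈ s then g k - (g k).transpose else g k) σ =
        2 ^ s.card * ∑ σ, pairTerm g σ := by
    induction s using Finset.induction_on with
    | empty => simp
    | insert k s hk ih =>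
      have := sum_pairTerm_update_sub_transpose
        (fun k => if k ∈ s then g k - (g k).transpose else g k) k
      rw [Finset.card_insert_of_notMem hk, pow_succ', mul_assoc, ← ih, ← this]
      refine Finset.sum_congr rfl fun σ _ => congrArg (pairTerm · σ) (funext fun l => ?_)
      rcases eq_or_ne l k with rfl | h
      · simp [hk]
      · simp [h]
  simpa using key Finset.univ

lemma exists_perm_pairTerm_mul (M : Matrix (Fin (2 * N)) (Fin (2 * N)) R)
    (hM : M.transpose = -M) (k₀ : Fin N) (c : Fin (2 * N)) :
    ∃ τ : Equiv.Perm (Fin (2 * N)), τ (pairFst k₀) = c ∧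
      ∀ σ, pairTerm (fun _ => M) (σ * τ) = pairTerm (fun _ => M) σ := by
  have hpair (k : Fin N) : ∃ τ : Equiv.Perm (Fin (2 * N)), τ (pairFst k₀) = pairFst k ∧
      τ (pairSnd k₀) = pairSnd k ∧
      ∀ σ, pairTerm (fun _ => M) (σ * τ) = pairTerm (fun _ => M) σ := by
    rcases eq_or_ne k₀ k with rfl | hk
    · exact ⟨1, by simp⟩
    let τ := Equiv.swap (pairFst k₀) (pairFst k) * Equiv.swap (pairSnd k₀) (pairSnd k)
    have hfst (l : Fin N) : τ (pairFst l) = pairFst (Equiv.swap k₀ k l) := by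
      simp only [τ, Equiv.Perm.mul_apply]
      rw [Equiv.swap_apply_of_ne_of_ne (pairFst_ne_pairSnd _ _) (pairFst_ne_pairSnd _ _)]
      simp only [Equiv.swap_apply_def, pairFst_inj]
      split_ifs <;> rfl
    have hsnd (l : Fin N) : τ (pairSnd l) = pairSnd (Equiv.swap k₀ k l) := by
      simp only [τ, Equiv.Perm.mul_apply]
      rw [Equiv.swap_apply_def (pairSnd k₀), Equiv.swap_apply_def k₀]
      simp only [pairSnd_inj]
      split_ifs <;> exact Equiv.swap_apply_of_ne_of_ne
        (pairFst_ne_pairSnd _ _).symm (pairFst_ne_pairSnd _ _).symm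
    refine ⟨τ, by simp [hfst], by simp [hsnd], fun σ => ?_⟩
    have hsign : Equiv.Perm.sign τ = 1 := by
      simp [τ, Equiv.Perm.sign_mul, Equiv.Perm.sign_swap', pairFst_inj, pairSnd_inj, hk]
    simp only [pairTerm, Equiv.Perm.sign_mul, hsign, mul_one, Equiv.Perm.mul_apply, hfst, hsnd]
    congr 1
    exact Equiv.prod_comp (Equiv.swap k₀ k) fun l => M (σ (pairFst l)) (σ (pairSnd l))
  have hswap (σ) : pairTerm (fun _ => M) (σ * Equiv.swap (pairFst k₀) (pairSnd k₀)) =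
      pairTerm (fun _ => M) σ := by
    rw [pairTerm_mul_swap, hM]
    unfold pairTerm
    rw [← Finset.mul_prod_erase _ _ (Finset.mem_univ k₀),
      ← Finset.mul_prod_erase Finset.univ (fun k => M _ _) (Finset.mem_univ k₀),
      Function.update_self, Matrix.neg_apply, neg_mul, mul_neg, neg_neg]
    congr 2
    refine Finset.prod_congr rfl fun l hl => ?_
    rw [Function.update_of_ne (Finset.ne_of_mem_erase hl)]
  obtain ⟨k, rfl | rfl⟩ := exists_eq_pairFst_or_eq_pairSnd c
  · obtain ⟨τ, h1, -, h3⟩ := hpair k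
    exact ⟨τ, h1, h3⟩
  · obtain ⟨τ, -, h2, h3⟩ := hpair k
    refine ⟨τ * Equiv.swap (pairFst k₀) (pairSnd k₀), by simp [h2], fun σ => ?_⟩
    rw [← mul_assoc, hswap, h3]

lemma sum_perm_ite_apply_zero {n : ℕ} (f : Equiv.Perm (Fin (n + 1)) → R) :
    ∑ σ, (if σ 0 = 0 then f σ else 0) =
      ∑ e : Equiv.Perm (Fin n), f (Equiv.Perm.decomposeFin.symm (0, e)) := by
  rw [← Equiv.Perm.decomposeFin.symm.sum_comp, Fintype.sum_prod_type,
    Finset.sum_eq_single 0] <;> simp +contextual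

lemma sum_perm_eq_card_mul {n : ℕ} (f : Equiv.Perm (Fin (n + 1)) → R)
    (hf : ∀ c, ∃ τ : Equiv.Perm (Fin (n + 1)), τ 0 = c ∧ ∀ σ, f (σ * τ) = f σ) :
    ∑ σ, f σ = (n + 1 : ℕ) * ∑ σ, (if σ 0 = 0 then f σ else 0) := by
  calc ∑ σ, f σ = ∑ σ : Equiv.Perm (Fin (n + 1)), ∑ c, if σ c = 0 then f σ else 0 := by
        simp [← Equiv.eq_symm_apply]
    _ = ∑ c, ∑ σ : Equiv.Perm (Fin (n + 1)), if σ c = 0 then f σ else 0 := Finset.sum_comm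
    _ = ∑ c : Fin (n + 1), ∑ σ : Equiv.Perm (Fin (n + 1)), if σ 0 = 0 then f σ else 0 := by
        refine Finset.sum_congr rfl fun c _ => ?_
        obtain ⟨τ, rfl, h⟩ := hf c
        rw [← Equiv.sum_comp (Equiv.mulRight τ) fun σ => if σ 0 = 0 then f σ else 0]
        simp [h]
    _ = _ := by
        rw [Finset.sum_const, Finset.card_univ, Fintype.card_fin, nsmul_eq_mul]

lemma sum_perm_eq_sum_cycleRange {n : ℕ} (f : Equiv.Perm (Fin (n + 1)) → R) :
    ∑ σ, f σ = ∑ p : Fin (n + 1), ∑ e : Equiv.Perm (Fin n),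
      f (p.cycleRange.symm * Equiv.Perm.decomposeFin.symm (0, e)) := by
  calc ∑ σ, f σ = ∑ σ, ∑ p, if σ 0 = p then f σ else 0 := by simp
    _ = ∑ p, ∑ σ, if σ 0 = p then f σ else 0 := Finset.sum_comm
    _ = _ := by
      refine Finset.sum_congr rfl fun p _ => ?_
      rw [← sum_perm_ite_apply_zero (fun σ => f (p.cycleRange.symm * σ)),
        ← Equiv.sum_comp (Equiv.mulLeft p.cycleRange.symm)]
      refine Finset.sum_congr rfl fun σ _ => ?_
      simp only [Equiv.coe_mulLeft, Equiv.Perm.mul_apply, Equiv.symm_apply_eq,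
        Fin.cycleRange_self]

lemma sum_pairTerm_eq_pf : ∀ {N : ℕ} (M : Matrix (Fin (2 * N)) (Fin (2 * N)) R),
    M.transpose = -M →
      ∑ σ, pairTerm (fun _ => M) σ = 2 ^ N * (N.factorial : R) * pf (2 * N) M
  | 0, M, _ => by
    simp [pairTerm, pf]
  | N + 1, M, hM => by
    have hfirst := sum_perm_eq_card_mul (n := 2 * N + 1) (pairTerm (N := N + 1) fun _ => M)
      (exists_perm_pairTerm_mul M hM 0)
    refine hfirst.trans ?_
    rw [sum_perm_ite_apply_zero, sum_perm_eq_sum_cycleRange]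
    have hminor (p : Fin (2 * N + 1)) :
        ∑ e : Equiv.Perm (Fin (2 * N)), pairTerm (N := N + 1) (fun _ => M)
          (Equiv.Perm.decomposeFin.symm
            (0, p.cycleRange.symm * Equiv.Perm.decomposeFin.symm (0, e))) =
        (-1) ^ (p : ℕ) * M (0 : Fin (2 * N + 2)) p.succ * (2 ^ N * (N.factorial : R) *
          pf (2 * N) (((show Matrix (Fin (2 * N + 2)) (Fin (2 * N + 2)) R from M).submatrix
            Fin.succ Fin.succ).submatrix p.succAbove p.succAbove)) := by
      rw [← sum_pairTerm_eq_pf, Finset.mul_sum]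
      · refine Finset.sum_congr rfl fun e _ => ?_
        have h0 : pairFst (0 : Fin (N + 1)) = (0 : Fin (2 * N + 1 + 1)) := rfl
        have h1 : pairSnd (0 : Fin (N + 1)) = (0 : Fin (2 * N + 1)).succ := rfl
        have h2 (k : Fin N) : pairFst k.succ = (pairFst k).succ.succ := rfl
        have h3 (k : Fin N) : pairSnd k.succ = (pairSnd k).succ.succ := rfl
        simp only [pairTerm]
        rw [Fin.prod_univ_succ]
        simp only [h0, h1, h2, h3]
        simp only [Equiv.Perm.decomposeFin.symm_sign, Equiv.Perm.decomposeFin_symm_apply_zero,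
          Equiv.Perm.decomposeFin_symm_apply_succ, Equiv.Perm.mul_apply, Equiv.swap_self,
          Equiv.refl_apply, Fin.cycleRange_symm_zero, Fin.cycleRange_symm_succ,
          Equiv.Perm.sign_mul, Equiv.Perm.sign_symm, Fin.sign_cycleRange, Matrix.submatrix_apply,
          if_true, one_mul]
        push_cast
        ring
      · ext i j
        exact congrFun (congrFun hM _) _
    simp_rw [hminor]
    change _ = _ * pf (2 * N + 2) M
    rw [pf, Finset.mul_sum, Finset.mul_sum]
    refine Finset.sum_congr rfl fun p _ => ?_
    rw [Nat.factorial_succ]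
    push_cast
    ring

end Pairs

lemma det_of_pairs {R : Type*} [CommRing R] {N : ℕ} (A : Matrix (Fin (2 * N)) (Fin (2 * N)) R) :
    A.det = ∑ σ, pairTerm (fun k => Matrix.of fun i j => A i (pairFst k) * A j (pairSnd k)) σ := by
  rw [Matrix.det_apply']
  refine Finset.sum_congr rfl fun σ _ => ?_
  rw [prod_eq_prod_pairs]
  rfl

/-- de Bruijn quaternionic-type formula: for functions
`φᵢ, ψᵢ` on `[a,b]`,
`∫_a^b ⋯ ∫_a^b det[φᵢ(xⱼ), ψᵢ(xⱼ)] dx₁⋯dx_N = N! · Pf(M)` with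
`M i j = ∫_a^b (φᵢ ψⱼ - φⱼ ψᵢ)`. The `2N` columns of the determinant come in
pairs: column `2j` is `(φᵢ(xⱼ))ᵢ` and column `2j+1` is `(ψᵢ(xⱼ))ᵢ`. -/
theorem deBruijn_quaternionic (N : ℕ) (a b : ℝ) (φ ψ : Fin (2 * N) → ℝ → ℝ)
    (hint : IntegrableOn
      (fun u : Fin N → ℝ =>
        (Matrix.of fun i (c : Fin (2 * N)) =>
          if (c : ℕ) % 2 = 0 then φ i (u ⟨(c : ℕ) / 2, by have := c.isLt; omega⟩)
          else ψ i (u ⟨(c : ℕ) / 2, by have := c.isLt; omega⟩)).det)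
      {u : Fin N → ℝ | ∀ k, u k ∈ Set.Icc a b})
    (hint2 : ∀ i j : Fin (2 * N), IntegrableOn
      (fun x => φ i x * ψ j x - φ j x * ψ i x) (Set.Icc a b)) :
    (∫ u in {u : Fin N → ℝ | ∀ k, u k ∈ Set.Icc a b},
      (Matrix.of fun i (c : Fin (2 * N)) =>
        if (c : ℕ) % 2 = 0 then φ i (u ⟨(c : ℕ) / 2, by have := c.isLt; omega⟩)
        else ψ i (u ⟨(c : ℕ) / 2, by have := c.isLt; omega⟩)).det)
      = (N.factorial : ℝ) * pf (2 * N) (Matrix.of fun i j =>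
          ∫ x in Set.Icc a b, (φ i x * ψ j x - φ j x * ψ i x)) := by
  set F : (Fin N → ℝ) → Fin N → Matrix (Fin (2 * N)) (Fin (2 * N)) ℝ :=
    fun u k => Matrix.of fun i j => φ i (u k) * ψ j (u k) - φ j (u k) * ψ i (u k) with hF
  set M : Matrix (Fin (2 * N)) (Fin (2 * N)) ℝ := Matrix.of fun i j =>
    ∫ x in Set.Icc a b, (φ i x * ψ j x - φ j x * ψ i x) with hMdef
  have hM : M.transpose = -M := by
    ext i j
    simp only [hMdef, Matrix.transpose_apply, Matrix.neg_apply, Matrix.of_apply]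
    rw [← integral_neg]
    simp only [neg_sub]
  have hdet (u : Fin N → ℝ) : (Matrix.of fun i (c : Fin (2 * N)) =>
        if (c : ℕ) % 2 = 0 then φ i (u ⟨(c : ℕ) / 2, by have := c.isLt; omega⟩)
        else ψ i (u ⟨(c : ℕ) / 2, by have := c.isLt; omega⟩)).det =
      (2 ^ N)⁻¹ * ∑ σ, pairTerm (F u) σ := by
    rw [eq_inv_mul_iff_mul_eq₀ (by positivity), det_of_pairs, ← sum_pairTerm_sub_transpose]
    refine Finset.sum_congr rfl fun σ _ => congrArg (pairTerm · σ) (funext fun k => ?_)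
    have h1 : (2 * (k : ℕ) + 1) / 2 = k := by omega
    have h2 : (2 * (k : ℕ) + 1) % 2 = 1 := by omega
    ext i j
    simp [hF, pairFst, pairSnd, h1, h2]
  have hset : {u : Fin N → ℝ | ∀ k, u k ∈ Set.Icc a b} =
      Set.univ.pi fun _ => Set.Icc a b := by
    ext u; simp only [Set.mem_ofPred_eq, Set.mem_univ_pi]
  simp_rw [hdet]
  rw [hset, volume_pi, Measure.restrict_pi_pi, integral_const_mul, integral_finsetSum]
  · have hterm (σ : Equiv.Perm (Fin (2 * N))) :
        ∫ u, pairTerm (F u) σ ∂Measure.pi (fun _ : Fin N => volume.restrict (Set.Icc a b)) =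
          pairTerm (fun _ => M) σ := by
      simp only [pairTerm]
      rw [integral_const_mul]
      congr 1
      exact integral_fintype_prod_eq_prod fun k x =>
        φ (σ (pairFst k)) x * ψ (σ (pairSnd k)) x - φ (σ (pairSnd k)) x * ψ (σ (pairFst k)) x
    simp_rw [hterm]
    rw [sum_pairTerm_eq_pf M hM]
    field_simp
  · intro σ _
    simp only [pairTerm]
    exact (Integrable.fintype_prod (f := fun k x =>
      φ (σ (pairFst k)) x * ψ (σ (pairSnd k)) x - φ (σ (pairSnd k)) x * ψ (σ (pairFst k)) x)
      fun k => hint2 _ _).const_mul _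
end
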